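/- Let λ ∈ ℂ* act on ℂ[x₁,x₂,x₃,x₅,x₆] by the ℂ-algebra automorphism x₁ ↦ x₁, x₂ ↦ λx₂, x₃ ↦ λx₃, x₅ ↦ λ⁻¹x₅, x₆ ↦ λ⁻¹x₆. Then a polynomial f ∈ ℂ[x₁,x₂,x₃,x₅,x₆] is invariant under this action for all λ ∈ ℂ* if and only if f lies in the ℂ-subalgebra generated by the monomials x₁, x₂x₅, x₃x₆, x₂x₆, x₃x₅. -/

import Mathlib

open MvPolynomial

theorem coeff_aeval_C_mul_X {σ R : Type*} [Fintype σ] [CommSemiring R] (c : σ → R)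
    (f : MvPolynomial σ R) (d : σ →₀ ℕ) :
    coeff d (aeval (fun i => C (c i) * X i : σ → MvPolynomial σ R) f)
      = (∏ i, c i ^ d i) * coeff d f := by
  classical
  induction f using MvPolynomial.induction_on' with
  | monomial u a =>
    have h : aeval (fun i => C (c i) * X i : σ → MvPolynomial σ R) (monomial u a)
        = monomial u ((∏ i, c i ^ u i) * a) := by
      rw [aeval_monomial, Finsupp.prod_fintype _ _ (by simp), monomial_eq,
        Finsupp.prod_fintype _ _ (by simp)]
      simp only [mul_pow, Finset.prod_mul_distrib, map_mul, map_prod, map_pow,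
        MvPolynomial.algebraMap_eq]
      ring
    rw [h, coeff_monomial, coeff_monomial]
    split_ifs with hud
    · rw [hud]
    · simp
  | add p q hp hq => rw [map_add, coeff_add, coeff_add, hp, hq, mul_add]

theorem Subalgebra.balanced_monomial_mem {R A : Type*} [CommSemiring R] [CommSemiring A]
    [Algebra R A] (S : Subalgebra R A) {x y z w : A} (hxz : x * z ∈ S) (hyw : y * w ∈ S)
    (hxw : x * w ∈ S) (hyz : y * z ∈ S) {a b c d : ℕ} (h : a + b = c + d) :
    x ^ a * y ^ b * z ^ c * w ^ d ∈ S := by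
  rcases le_total a c with hac | hac
  · obtain ⟨k, rfl⟩ := Nat.exists_eq_add_of_le hac
    obtain rfl : b = k + d := by lia
    have : x ^ a * y ^ (k + d) * z ^ (a + k) * w ^ d
        = (x * z) ^ a * (y * z) ^ k * (y * w) ^ d := by ring
    rw [this]
    exact mul_mem (mul_mem (pow_mem hxz _) (pow_mem hyz _)) (pow_mem hyw _)
  · obtain ⟨k, rfl⟩ := Nat.exists_eq_add_of_le hac
    obtain rfl : d = k + b := by lia
    have : x ^ (c + k) * y ^ b * z ^ c * w ^ (k + b)
        = (x * z) ^ c * (x * w) ^ k * (y * w) ^ b := by ring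
    rw [this]
    exact mul_mem (mul_mem (pow_mem hxz _) (pow_mem hxw _)) (pow_mem hyw _)

/-- λ ∈ ℂ* acts on ℂ[x₁,x₂,x₃,x₅,x₆] (indices 0,1,2,3,4 standing for x₁,x₂,x₃,x₅,x₆)
by x₁ ↦ x₁, x₂ ↦ λx₂, x₃ ↦ λx₃, x₅ ↦ λ⁻¹x₅, x₆ ↦ λ⁻¹x₆.
A polynomial is invariant iff it lies in the subalgebra generated by
x₁, x₂x₅, x₃x₆, x₂x₆, x₃x₅. -/
theorem stmt_2 (f : MvPolynomial (Fin 5) ℂ) :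
    (∀ l : ℂ, l ≠ 0 →
      aeval (fun i : Fin 5 =>
        C (![1, l, l, l⁻¹, l⁻¹] i) * X i) f = f) ↔
    f ∈ Algebra.adjoin ℂ
      ({X 0, X 1 * X 3, X 2 * X 4, X 1 * X 4, X 2 * X 3} :
        Set (MvPolynomial (Fin 5) ℂ)) := by
  constructor
  · intro h
    set S := Algebra.adjoin ℂ
      ({X 0, X 1 * X 3, X 2 * X 4, X 1 * X 4, X 2 * X 3} : Set (MvPolynomial (Fin 5) ℂ))
    rw [f.as_sum]
    refine sum_mem fun d hd => ?_
    have hbal : d 1 + d 2 = d 3 + d 4 := by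
      have h2 := congrArg (coeff d) (h 2 two_ne_zero)
      rw [coeff_aeval_C_mul_X] at h2
      have h3 := mul_right_cancel₀ (mem_support_iff.mp hd) (h2.trans (one_mul _).symm)
      simp only [Fin.prod_univ_five, Matrix.cons_val, one_pow, one_mul, inv_pow] at h3
      field_simp at h3
      rw [← pow_add, ← pow_add] at h3
      exact Nat.pow_right_injective le_rfl (by exact_mod_cast h3)
    rw [monomial_eq, Finsupp.prod_fintype _ _ (by simp), Fin.prod_univ_five]
    have hmem := S.balanced_monomial_mem (x := X 1) (y := X 2) (z := X 3) (w := X 4)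
      (Algebra.subset_adjoin (by simp)) (Algebra.subset_adjoin (by simp))
      (Algebra.subset_adjoin (by simp)) (Algebra.subset_adjoin (by simp)) hbal
    have h0 : (X 0 : MvPolynomial (Fin 5) ℂ) ∈ S := Algebra.subset_adjoin (by simp)
    convert mul_mem (mul_mem (S.algebraMap_mem (coeff d f)) (pow_mem h0 (d 0))) hmem using 1
    rw [MvPolynomial.algebraMap_eq]
    ring
  · intro hf l hl
    have hC : (C l * C l⁻¹ : MvPolynomial (Fin 5) ℂ) = 1 := by
      rw [← C_mul, mul_inv_cancel₀ hl, C_1]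
    induction hf using Algebra.adjoin_induction with
    | mem x hx =>
      rcases hx with rfl | rfl | rfl | rfl | rfl <;>
        simp only [map_mul, aeval_X, Matrix.cons_val, C_1, one_mul] <;>
        rw [mul_mul_mul_comm, hC, one_mul]
    | algebraMap r => exact AlgHom.commutes _ r
    | add x y _ _ hx hy => rw [map_add, hx, hy]
    | mul x y _ _ hx hy => rw [map_mul, hx, hy]
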